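/- Let J be a norm-closed two-sided ideal in a von Neumann algebra M, J_0 the ideal of M generated by the projections in J, A a C*-algebra, and π : A → M a unital *-homomorphism. If {A_i : i ∈ I} is an increasingly directed family of unital C*-subalgebras of A with A equal to the norm closure of ∪_{i∈I} A_i, then the norm closure of ∪_{i∈I} (A_i ∩ π^{-1}(J_0)) equals π^{-1}(J). -/

import Mathlib

/-!
Statement 7: Let `J` be a norm-closed two-sided ideal in a von Neumann algebra `M`, `J₀` the
ideal of `M` generated by the projections in `J`, `A` a C*-algebra and `π : A → M` a unital
*-homomorphism.  If `{A_i : i ∈ I}` is an increasingly directed family of unital closed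
C*-subalgebras of `A` with `A` equal to the norm closure of `⋃ᵢ A_i`, then the norm closure
of `⋃ᵢ (A_i ∩ π⁻¹(J₀))` equals `π⁻¹(J)`.
-/

noncomputable section

/-- A projection in a *-algebra: a self-adjoint idempotent. -/
def IsProjElem {R : Type*} [Mul R] [Star R] (p : R) : Prop := star p = p ∧ p * p = p

/-- `I` is a two-sided ideal of the algebra (given as the subset) `Mset`. -/
def IsIdealOf {R : Type*} [NonUnitalNonAssocSemiring R] (Mset I : Set R) : Prop :=
  I ⊆ Mset ∧ (0 : R) ∈ I ∧ (∀ x ∈ I, ∀ y ∈ I, x + y ∈ I) ∧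
    ∀ x ∈ I, ∀ m ∈ Mset, m * x ∈ I ∧ x * m ∈ I

/-- The two-sided ideal of `Mset` generated by the subset `S`. -/
def idealGenBy {R : Type*} [NonUnitalNonAssocSemiring R] (Mset S : Set R) : Set R :=
  ⋂₀ {I : Set R | IsIdealOf Mset I ∧ S ⊆ I}

/-- The orthogonal projection onto the kernel of an element of a von Neumann algebra belongs to
the algebra. -/
theorem VonNeumannAlgebra.starProjection_ker_mem {H : Type*} [NormedAddCommGroup H]
    [InnerProductSpace ℂ H] [CompleteSpace H] (M : VonNeumannAlgebra H) {T : H →L[ℂ] H}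
    (hT : T ∈ M) [T.ker.HasOrthogonalProjection] : T.ker.starProjection ∈ M := by
  rw [VonNeumannAlgebra.IsStarProjection.mem_iff isStarProjection_starProjection]
  intro y hy
  rw [Submodule.range_starProjection, Module.End.mem_invtSubmodule_iff_forall_mem_of_mem]
  intro x hx
  have hxy := DFunLike.congr_fun (VonNeumannAlgebra.mem_commutant_iff.1 hy T hT) x
  have hx' : T x = 0 := hx
  change T (y x) = 0
  simpa [hx'] using hxy

theorem idealGenBy_subset {R : Type*} [NonUnitalNonAssocSemiring R] {Mset J S : Set R}
    (hJ : IsIdealOf Mset J) (hS : S ⊆ J) : idealGenBy Mset S ⊆ J :=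
  fun _ hx => hx J ⟨hJ, hS⟩

theorem mul_mem_idealGenBy {R : Type*} [NonUnitalNonAssocSemiring R] {Mset S : Set R} {m p : R}
    (hm : m ∈ Mset) (hp : p ∈ S) : m * p ∈ idealGenBy Mset S :=
  fun _ hI => (hI.1.2.2.2 p (hI.2 hp) m hm).1

/-- If `T = T * K` with `T` in the von Neumann algebra `M` and `K` in the ideal `J`, then
every left multiple of `T` lies in the ideal generated by the projections of `J`. -/
theorem mul_mem_idealGenBy_proj {H : Type*} [NormedAddCommGroup H] [InnerProductSpace ℂ H]
    [CompleteSpace H] {M : VonNeumannAlgebra H} {J : Set (H →L[ℂ] H)}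
    (hJ : IsIdealOf (M : Set (H →L[ℂ] H)) J) {B T K : H →L[ℂ] H} (hB : B ∈ M) (hT : T ∈ M)
    (hK : K ∈ J) (hTK : T * K = T) :
    B * T ∈ idealGenBy (M : Set (H →L[ℂ] H)) {p | p ∈ J ∧ IsProjElem p} := by
  have : CompleteSpace T.ker := T.isClosed_ker.completeSpace_coe
  set Q : H →L[ℂ] H := T.ker.starProjection with hQ
  have hQM : Q ∈ M := M.starProjection_ker_mem hT
  have hproj : IsStarProjection (1 - Q) := isStarProjection_starProjection.one_sub
  have hPM : 1 - Q ∈ M := sub_mem (one_mem M) hQM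
  have hTQ : T * Q = 0 := by
    ext x
    exact Submodule.starProjection_apply_mem T.ker x
  have hQK : Q * (1 - K) = 1 - K := by
    ext x
    refine Submodule.starProjection_eq_self_iff.2 ?_
    change T ((1 - K) x) = 0
    simpa [sub_eq_zero] using (DFunLike.congr_fun hTK x).symm
  have hPK : (1 - Q) * K = 1 - Q := by
    have h : (1 - Q) * K = (1 - Q) - ((1 - K) - Q * (1 - K)) := by noncomm_ring
    rw [h, hQK, sub_self, sub_zero]
  have hPJ : 1 - Q ∈ J := hPK ▸ (hJ.2.2.2 K hK _ hPM).1
  have hBT : B * T = B * T * (1 - Q) := by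
    rw [mul_sub, mul_one, mul_assoc B T Q, hTQ, mul_zero, sub_zero]
  rw [hBT]
  exact mul_mem_idealGenBy (mul_mem hB hT) ⟨hPJ, hproj.isSelfAdjoint, hproj.isIdempotentElem⟩

/-- Cut-offs of `star b * b` by continuous functional calculus: `k` and `g` vanish on `[0, ε]` and
`[0, 2ε]` and are `1` on `[2ε, ∞)` and `[3ε, ∞)`, and `r` inverts `star b * b` on `[ε, ∞)`. -/
theorem exists_cutoff {A : Type*} [CStarAlgebra A] (S : StarSubalgebra ℂ A)
    (hS : IsClosed (S : Set A)) {b : A} (hb : b ∈ S) {ε : ℝ} (hε : 0 < ε) :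
    ∃ r k g : A, ‖r‖ ≤ ε⁻¹ ∧ k * r * (star b * b) = k ∧ g * k = g ∧ g ∈ S ∧
      ‖b - b * g‖ ^ 2 ≤ 3 * ε := by
  set h := star b * b with hh
  have hsa : IsSelfAdjoint h := .star_mul_self b
  have hspec : ∀ x ∈ spectrum ℝ h, 0 ≤ x := spectrum_star_mul_self_nonneg
  let r : ℝ → ℝ := fun t => (max ε t)⁻¹
  let k : ℝ → ℝ := fun t => min 1 (max 0 (t - ε) * ε⁻¹)
  let g : ℝ → ℝ := fun t => min 1 (max 0 (t - 2 * ε) * ε⁻¹)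
  have hr : Continuous r :=
    (continuous_const.max continuous_id).inv₀ fun t => (lt_max_of_lt_left hε).ne'
  have hk : Continuous k := by fun_prop
  have hg : Continuous g := by fun_prop
  have hid : cfc (fun t : ℝ => t) h = h := cfc_id' ℝ h
  have hg0 : ∀ t, 0 ≤ g t := fun t => by positivity
  have hg1 : ∀ t, g t ≤ 1 := fun t => min_le_left _ _
  refine ⟨cfc r h, cfc k h, cfc g h, ?_, ?_, ?_, ?_, ?_⟩
  · refine norm_cfc_le (by positivity) fun t _ => ?_
    have : 0 < max ε t := lt_max_of_lt_left hε
    rw [Real.norm_of_nonneg (by positivity)]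
    exact inv_anti₀ hε (le_max_left _ _)
  · have hmul : cfc k h * cfc r h * h = cfc (fun t => k t * r t * t) h := by
      rw [cfc_mul (fun t => k t * r t) (fun t => t) h (hk.mul hr).continuousOn
        continuousOn_id, hid, cfc_mul k r h hk.continuousOn hr.continuousOn]
    rw [hmul]
    congr 1
    ext t
    rcases le_total t ε with ht | ht
    · have : k t = 0 := by simp [k, max_eq_left (sub_nonpos.2 ht)]
      simp [this]
    · have : r t * t = 1 := by
        simp only [r]
        rw [max_eq_right ht, inv_mul_cancel₀ (hε.trans_le ht).ne']
      rw [mul_assoc, this, mul_one]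
  · rw [← cfc_mul g k h hg.continuousOn hk.continuousOn]
    congr 1
    ext t
    rcases le_total t (2 * ε) with ht | ht
    · have : g t = 0 := by
        simp only [g]
        rw [max_eq_left (by linarith)]; simp
      simp [this]
    · have : k t = 1 := by
        simp only [k]
        rw [min_eq_left]
        rw [max_eq_right (by linarith), ← div_eq_mul_inv, le_div_iff₀ hε]
        linarith
      simp [this]
  · have hmem : h ∈ S := mul_mem (star_mem hb) hb
    exact cfc_mem (𝕜 := ℝ) (𝕜' := ℂ) g hmem
  · have hc : b - b * cfc g h = b * cfc (fun t => 1 - g t) h := by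
      rw [cfc_sub (fun _ => (1 : ℝ)) g h continuousOn_const hg.continuousOn, cfc_const_one ℝ h,
        mul_sub, mul_one]
    have hcs : star (cfc (fun t => 1 - g t) h) = cfc (fun t => 1 - g t) h :=
      (cfc_predicate _ h : IsSelfAdjoint _)
    have hsq : star (b * cfc (fun t => 1 - g t) h) * (b * cfc (fun t => 1 - g t) h) =
        cfc (fun t => (1 - g t) * t * (1 - g t)) h := by
      have hcont : Continuous fun t => 1 - g t := continuous_const.sub hg
      rw [cfc_mul (fun t => (1 - g t) * t) (fun t => 1 - g t) h
        (hcont.mul continuous_id).continuousOn hcont.continuousOn,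
        cfc_mul (fun t => 1 - g t) (fun t => t) h hcont.continuousOn continuousOn_id, hid,
        star_mul, hcs, hh]
      simp only [mul_assoc]
    rw [hc, pow_two, ← CStarRing.norm_star_mul_self, hsq]
    refine norm_cfc_le (by positivity) fun t ht => ?_
    have ht0 := hspec t ht
    have h0 : 0 ≤ 1 - g t := sub_nonneg.2 (hg1 t)
    rw [Real.norm_of_nonneg (by positivity)]
    rcases le_total t (3 * ε) with h3 | h3
    · calc (1 - g t) * t * (1 - g t) ≤ 1 * t * 1 := by
            gcongr <;> linarith [hg0 t]
        _ ≤ 3 * ε := by linarith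
    · have : g t = 1 := by
        simp only [g]
        rw [min_eq_left]
        rw [max_eq_right (by linarith), ← div_eq_mul_inv, le_div_iff₀ hε]
        linarith
      rw [this, sub_self, mul_zero]
      positivity

theorem stmt7 {H : Type*} [NormedAddCommGroup H] [InnerProductSpace ℂ H] [CompleteSpace H]
    {A : Type*} [NormedRing A] [StarRing A] [CStarRing A] [NormedAlgebra ℂ A]
    [StarModule ℂ A] [CompleteSpace A]
    (M : VonNeumannAlgebra H) (J : Set (H →L[ℂ] H))
    (hJ : IsIdealOf (M : Set (H →L[ℂ] H)) J) (hJclosed : IsClosed J)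
    (J₀ : Set (H →L[ℂ] H))
    (hJ₀ : J₀ = idealGenBy (M : Set (H →L[ℂ] H)) {p | p ∈ J ∧ IsProjElem p})
    (π : A →⋆ₐ[ℂ] (H →L[ℂ] H)) (hπM : ∀ a : A, π a ∈ M)
    {ι : Type*} (𝒜 : ι → StarSubalgebra ℂ A)
    (hdir : Directed (· ≤ ·) 𝒜)
    (hclosed : ∀ i, IsClosed ((𝒜 i : Set A)))
    (hdense : closure (⋃ i, (𝒜 i : Set A)) = Set.univ) :
    closure (⋃ i, ((𝒜 i : Set A) ∩ ((fun a : A => π a) ⁻¹' J₀))) =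
      (fun a : A => π a) ⁻¹' J := by
  let _ : CStarAlgebra A := {}
  have hπ : Continuous (fun a : A => π a) :=
    AddMonoidHomClass.continuous_of_bound π 1 fun a => by
      simpa only [one_mul] using NonUnitalStarAlgHom.norm_apply_le π a
  subst hJ₀
  apply Set.Subset.antisymm
  · refine closure_minimal (Set.iUnion_subset fun i a ha => ?_) (hJclosed.preimage hπ)
    exact idealGenBy_subset hJ (fun p hp => hp.1) ha.2
  · intro a ha
    have haJ : π a ∈ J := ha
    rw [Metric.mem_closure_iff]
    intro δ hδ
    obtain ⟨ε, hε, hεδ⟩ : ∃ ε : ℝ, 0 < ε ∧ 3 * ε < (δ / 2) ^ 2 :=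
      ⟨δ ^ 2 / 16, by positivity, by nlinarith [sq_pos_of_pos hδ]⟩
    have hU : IsOpen ({b : A | ‖star b * b - star a * a‖ < ε} ∩ {b : A | ‖a - b‖ < δ / 2}) :=
      (isOpen_lt (by fun_prop) continuous_const).inter (isOpen_lt (by fun_prop) continuous_const)
    obtain ⟨b, ⟨hb₁, hb₂⟩, hb⟩ := mem_closure_iff.1 (hdense ▸ Set.mem_univ a) _ hU
      ⟨by simpa using hε, by simpa using hδ⟩
    rw [Set.mem_ofPred_eq] at hb₁ hb₂
    obtain ⟨i, hbi⟩ := Set.mem_iUnion.1 hb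
    obtain ⟨r, k, g, hr, hkr, hgk, hgS, hbg⟩ := exists_cutoff (𝒜 i) (hclosed i) hbi hε
    have hkJ : π k ∈ J := by
      set y := r * (star b * b - star a * a) with hy
      have hy1 : ‖y‖ < 1 := calc
        ‖y‖ ≤ ‖r‖ * ‖star b * b - star a * a‖ := norm_mul_le _ _
        _ ≤ ε⁻¹ * ‖star b * b - star a * a‖ := by gcongr
        _ < ε⁻¹ * ε := by gcongr
        _ = 1 := inv_mul_cancel₀ hε.ne'
      have hky : k * (1 - y) = k * r * star a * a := by
        calc k * (1 - y) = k - k * r * (star b * b) + k * r * star a * a := by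
              rw [hy]; noncomm_ring
          _ = _ := by rw [hkr, sub_self, zero_add]
      have hmem : ∀ n : ℕ, π (k * (1 - y ^ n)) ∈ J := fun n => by
        rw [← mul_neg_geom_sum y n, ← mul_assoc, hky, map_mul, map_mul]
        exact (hJ.2.2.2 _ (hJ.2.2.2 _ haJ _ (hπM _)).1 _ (hπM _)).2
      have hlim : Filter.Tendsto (fun n : ℕ => k * (1 - y ^ n)) Filter.atTop (nhds k) := by
        simpa using ((tendsto_pow_atTop_nhds_zero_of_norm_lt_one hy1).const_sub 1).const_mul k
      exact hJclosed.mem_of_tendsto ((hπ.tendsto k).comp hlim) (Filter.Eventually.of_forall hmem)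
    refine ⟨b * g, Set.mem_iUnion.2 ⟨i, mul_mem hbi hgS, ?_⟩, ?_⟩
    · rw [Set.mem_preimage, map_mul]
      exact mul_mem_idealGenBy_proj hJ (hπM b) (hπM g) hkJ (by rw [← map_mul, hgk])
    · have h1 : ‖b - b * g‖ < δ / 2 :=
        lt_of_pow_lt_pow_left₀ 2 (by positivity) (hbg.trans_lt hεδ)
      calc dist a (b * g) = ‖(a - b) + (b - b * g)‖ := by rw [dist_eq_norm, sub_add_sub_cancel]
        _ ≤ ‖a - b‖ + ‖b - b * g‖ := norm_add_le _ _
        _ < δ := by linarith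

end
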